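/- Let S and S' be schemes on nonempty finite sets Ω and Ω' respectively, let φ : S → S' be an algebraic isomorphism, and let m be a nonnegative integer. If φ is extendable at every m-tuple x ∈ Ω^m, then for every integer k with 0 ≤ k ≤ m, φ is extendable at every k-tuple y ∈ Ω^k. -/

import Mathlib

/-- A coherent configuration on a set `Ω`: a partition `S` of `Ω × Ω` into nonempty
classes such that the diagonal is a union of classes (CC1), the converse of every class
is a class (CC2), and the intersection numbers are well defined (CC3). -/
def IsCoherentConfiguration {Ω : Type*} (S : Set (Set (Ω × Ω))) : Prop :=
  (∀ s ∈ S, s.Nonempty) ∧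
  (∀ p : Ω × Ω, ∃! s, s ∈ S ∧ p ∈ s) ∧
  (∃ T ⊆ S, {p : Ω × Ω | p.1 = p.2} = ⋃₀ T) ∧
  (∀ s ∈ S, Prod.swap '' s ∈ S) ∧
  (∀ r ∈ S, ∀ s ∈ S, ∀ t ∈ S, ∀ p ∈ t, ∀ q ∈ t,
    Nat.card {γ | (p.1, γ) ∈ r ∧ (γ, p.2) ∈ s} =
      Nat.card {γ | (q.1, γ) ∈ r ∧ (γ, q.2) ∈ s})

/-- `T` refines `S` (i.e. `S ≤ T`): every class of `S` is a union of classes of `T`. -/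
def Refines {Ω : Type*} (S T : Set (Set (Ω × Ω))) : Prop :=
  ∀ s ∈ S, ∃ U ⊆ T, s = ⋃₀ U

/-- `T` is a point extension of `S` with respect to the tuple `x`: the smallest coherent
configuration refining `S` in which each `{(x i, x i)}` is a class. -/
def IsPointExtension {Ω : Type*} (S : Set (Set (Ω × Ω))) {m : ℕ} (x : Fin m → Ω)
    (T : Set (Set (Ω × Ω))) : Prop :=
  IsCoherentConfiguration T ∧ Refines S T ∧
  (∀ i : Fin m, ({(x i, x i)} : Set (Ω × Ω)) ∈ T) ∧
  ∀ T' : Set (Set (Ω × Ω)), IsCoherentConfiguration T' → Refines S T' →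
    (∀ i : Fin m, ({(x i, x i)} : Set (Ω × Ω)) ∈ T') → Refines T T'

/-- An algebraic isomorphism between two coherent configurations. -/
def IsAlgebraicIso {Ω Ω' : Type*} (S : Set (Set (Ω × Ω))) (S' : Set (Set (Ω' × Ω')))
    (φ : Set (Ω × Ω) → Set (Ω' × Ω')) : Prop :=
  Set.MapsTo φ S S' ∧ Set.InjOn φ S ∧ Set.SurjOn φ S S' ∧
  ∀ r ∈ S, ∀ s ∈ S, ∀ t ∈ S, ∀ p ∈ t, ∀ p' ∈ φ t,
    Nat.card {γ : Ω | (p.1, γ) ∈ r ∧ (γ, p.2) ∈ s} =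
      Nat.card {γ' : Ω' | (p'.1, γ') ∈ φ r ∧ (γ', p'.2) ∈ φ s}

/-- `ψ : T → T'` extends `φ : S → S'`: for every class `s` of `S`, `φ s` is the union
of the `ψ`-images of the classes of `T` contained in `s`. -/
def ExtendsAlgIso {Ω Ω' : Type*} (S T : Set (Set (Ω × Ω)))
    (φ ψ : Set (Ω × Ω) → Set (Ω' × Ω')) : Prop :=
  ∀ s ∈ S, φ s = ⋃₀ (ψ '' {u | u ∈ T ∧ u ⊆ s})

/-- `φ` is extendable at the tuple `x`: there is a tuple `x'`, point extensions with
respect to `x` and `x'`, and an algebraic isomorphism between them extending `φ` and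
mapping `{(x i, x i)}` to `{(x' i, x' i)}`. -/
def ExtendableAt {Ω Ω' : Type*} (S : Set (Set (Ω × Ω))) (S' : Set (Set (Ω' × Ω')))
    (φ : Set (Ω × Ω) → Set (Ω' × Ω')) {m : ℕ} (x : Fin m → Ω) : Prop :=
  ∃ (x' : Fin m → Ω') (T : Set (Set (Ω × Ω))) (T' : Set (Set (Ω' × Ω')))
    (ψ : Set (Ω × Ω) → Set (Ω' × Ω')),
    IsPointExtension S x T ∧ IsPointExtension S' x' T' ∧
    IsAlgebraicIso T T' ψ ∧ ExtendsAlgIso S T φ ψ ∧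
    ∀ i : Fin m, ψ {(x i, x i)} = {(x' i, x' i)}

/-- A relation between pairs of points which respects diagonals and converses, and along which
triangles can be transported bijectively. For an equivalence relation this says that its classes
form a coherent configuration. -/
structure IsMatching {Ω Ω' : Type*} (M : Ω × Ω → Ω' × Ω' → Prop) : Prop where
  left_total : ∀ p, ∃ p', M p p'
  right_total : ∀ p', ∃ p, M p p'
  diag : ∀ p p', M p p' → (p.1 = p.2 ↔ p'.1 = p'.2)
  swap : ∀ p p', M p p' → M p.swap p'.swap
  exists_equiv : ∀ p p', M p p' →
    ∃ e : Ω ≃ Ω', ∀ γ, M (p.1, γ) (p'.1, e γ) ∧ M (γ, p.2) (e γ, p'.2)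

namespace IsMatching

variable {Ω Ω' Ω'' : Type*} {M : Ω × Ω → Ω' × Ω' → Prop} {N : Ω' × Ω' → Ω'' × Ω'' → Prop}

theorem flip (h : IsMatching M) : IsMatching (flip M) where
  left_total := h.right_total
  right_total := h.left_total
  diag p p' hp := (h.diag p' p hp).symm
  swap p p' hp := h.swap p' p hp
  exists_equiv p p' hp := by
    obtain ⟨e, he⟩ := h.exists_equiv p' p hp
    exact ⟨e.symm, fun γ => by simpa [Function.flip_def] using he (e.symm γ)⟩

theorem comp (h : IsMatching M) (h' : IsMatching N) : IsMatching (Relation.Comp M N) where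
  left_total p := by
    obtain ⟨q, hq⟩ := h.left_total p
    obtain ⟨q', hq'⟩ := h'.left_total q
    exact ⟨q', q, hq, hq'⟩
  right_total p := by
    obtain ⟨q, hq⟩ := h'.right_total p
    obtain ⟨q', hq'⟩ := h.right_total q
    exact ⟨q', q, hq', hq⟩
  diag := by
    rintro p p' ⟨q, hq, hq'⟩
    exact (h.diag p q hq).trans (h'.diag q p' hq')
  swap := by
    rintro p p' ⟨q, hq, hq'⟩
    exact ⟨q.swap, h.swap p q hq, h'.swap q p' hq'⟩
  exists_equiv := by
    rintro p p' ⟨q, hq, hq'⟩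
    obtain ⟨e, he⟩ := h.exists_equiv p q hq
    obtain ⟨e', he'⟩ := h'.exists_equiv q p' hq'
    exact ⟨e.trans e', fun γ => ⟨⟨_, (he γ).1, (he' _).1⟩, ⟨_, (he γ).2, (he' _).2⟩⟩⟩

theorem eqvGen {R : Ω × Ω → Ω × Ω → Prop}
    (h : ∀ p q, R p q → ∃ r, IsMatching r ∧ r p q ∧ ∀ a b, r a b → Relation.EqvGen R a b) :
    IsMatching (Relation.EqvGen R) where
  left_total p := ⟨p, .refl p⟩
  right_total p := ⟨p, .refl p⟩
  diag p q hpq := by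
    induction hpq with
    | rel p q hpq =>
      obtain ⟨r, hr, hpq, -⟩ := h p q hpq
      exact hr.diag p q hpq
    | refl p => rfl
    | symm p q _ ih => exact ih.symm
    | trans p q u _ _ ih ih' => exact ih.trans ih'
  swap p q hpq := by
    induction hpq with
    | rel p q hpq =>
      obtain ⟨r, hr, hpq, hle⟩ := h p q hpq
      exact hle _ _ (hr.swap p q hpq)
    | refl p => exact .refl _
    | symm p q _ ih => exact ih.symm
    | trans p q u _ _ ih ih' => exact ih.trans _ _ _ ih'
  exists_equiv p q hpq := by
    induction hpq with
    | rel p q hpq =>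
      obtain ⟨r, hr, hpq, hle⟩ := h p q hpq
      obtain ⟨e, he⟩ := hr.exists_equiv p q hpq
      exact ⟨e, fun γ => ⟨hle _ _ (he γ).1, hle _ _ (he γ).2⟩⟩
    | refl p => exact ⟨Equiv.refl Ω, fun γ => ⟨.refl _, .refl _⟩⟩
    | symm p q _ ih =>
      obtain ⟨e, he⟩ := ih
      refine ⟨e.symm, fun γ => ?_⟩
      have := he (e.symm γ)
      rw [e.apply_symm_apply] at this
      exact ⟨this.1.symm, this.2.symm⟩
    | trans p q u _ _ ih ih' =>
      obtain ⟨e, he⟩ := ih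
      obtain ⟨e', he'⟩ := ih'
      exact ⟨e.trans e', fun γ =>
        ⟨(he γ).1.trans _ _ _ (he' _).1, (he γ).2.trans _ _ _ (he' _).2⟩⟩

theorem sSup {P : Set (Setoid (Ω × Ω))} (h : ∀ r ∈ P, IsMatching (r : Ω × Ω → Ω × Ω → Prop)) :
    IsMatching (sSup P : Setoid (Ω × Ω)) := by
  have key : IsMatching (Relation.EqvGen fun p q => ∃ r ∈ P, r p q) := by
    refine eqvGen fun p q ⟨r, hr, hpq⟩ => ⟨r, h r hr, hpq, fun a b hab => ?_⟩
    exact .rel _ _ ⟨r, hr, hab⟩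
  rw [Setoid.sSup_eq_eqvGen]
  exact key

end IsMatching

section Bridge

variable {Ω Ω' : Type*}

theorem Setoid.setOf_rel_mem_classes (r : Setoid Ω) (p : Ω) : {q | r q p} ∈ r.classes := ⟨p, rfl⟩

theorem Setoid.eq_setOf_rel_of_mem {r : Setoid Ω} {s : Set Ω} (hs : s ∈ r.classes) {p : Ω}
    (hp : p ∈ s) : s = {q | r q p} :=
  Setoid.eq_of_mem_classes hs hp (r.setOf_rel_mem_classes p) (r.refl p)

theorem refines_classes_iff {r t : Setoid (Ω × Ω)} : Refines r.classes t.classes ↔ t ≤ r := by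
  constructor
  · intro h p q hpq
    obtain ⟨U, hU, hs⟩ := h _ (r.setOf_rel_mem_classes q)
    have hq : q ∈ {x | r x q} := r.refl q
    rw [hs] at hq
    obtain ⟨u, hu, hqu⟩ := hq
    have hp : p ∈ ⋃₀ U := ⟨u, hu, by
      rw [Setoid.eq_setOf_rel_of_mem (hU hu) hqu]
      exact hpq⟩
    rw [← hs] at hp
    exact hp
  · rintro h _ ⟨p, rfl⟩
    refine ⟨{u | u ∈ t.classes ∧ u ⊆ {q | r q p}}, fun u hu => hu.1, ?_⟩
    refine Set.Subset.antisymm (fun q hq => ?_) (Set.sUnion_subset fun u hu => hu.2)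
    exact ⟨_, ⟨t.setOf_rel_mem_classes q, fun x hx => r.trans (h hx) hq⟩, t.refl q⟩

theorem singleton_mem_classes_iff {r : Setoid Ω} {p : Ω} :
    {p} ∈ r.classes ↔ ∀ q, r q p → q = p := by
  constructor
  · intro h q hq
    have := Setoid.eq_setOf_rel_of_mem h (Set.mem_singleton p)
    have hq' : q ∈ {q | r q p} := hq
    rwa [← this] at hq'
  · intro h
    refine ⟨p, Set.Subset.antisymm ?_ fun q hq => h q hq⟩
    rintro _ rfl
    exact r.refl _

theorem exists_equiv_of_card_fiber_eq [Finite Ω] [Finite Ω'] {C : Type*} (f : Ω → C) (g : Ω' → C)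
    (h : ∀ d, Nat.card {x // f x = d} = Nat.card {x // g x = d}) :
    ∃ e : Ω ≃ Ω', ∀ x, g (e x) = f x := by
  have e := fun d => Classical.choice (Finite.card_eq.1 (h d))
  exact ⟨(Equiv.sigmaFiberEquiv f).symm.trans
    ((Equiv.sigmaCongrRight e).trans (Equiv.sigmaFiberEquiv g)), fun x => (e (f x) ⟨x, rfl⟩).2⟩

theorem IsCoherentConfiguration.exists_classes_eq {S : Set (Set (Ω × Ω))}
    (hS : IsCoherentConfiguration S) : ∃ r : Setoid (Ω × Ω), r.classes = S := by
  have hpart : Setoid.IsPartition S := by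
    refine ⟨fun h => Set.not_nonempty_empty (hS.1 _ h), hS.2.1⟩
  exact ⟨Setoid.mkClasses S hpart.2, Setoid.classes_mkClasses S hpart⟩

theorem IsCoherentConfiguration.diag_iff {r : Setoid (Ω × Ω)}
    (hr : IsCoherentConfiguration r.classes) {p q : Ω × Ω} (hpq : r p q) :
    p.1 = p.2 ↔ q.1 = q.2 := by
  obtain ⟨U, hU, hd⟩ := hr.2.2.1
  have key : ∀ {p q : Ω × Ω}, r p q → q.1 = q.2 → p.1 = p.2 := by
    intro p q hpq hq
    have hq' : q ∈ {p : Ω × Ω | p.1 = p.2} := hq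
    rw [hd] at hq'
    obtain ⟨u, hu, hqu⟩ := hq'
    have hp : p ∈ ⋃₀ U := ⟨u, hu, by
      rw [Setoid.eq_setOf_rel_of_mem (hU hu) hqu]
      exact hpq⟩
    rw [← hd] at hp
    exact hp
  exact ⟨key (r.symm hpq), key hpq⟩

theorem IsCoherentConfiguration.swap {r : Setoid (Ω × Ω)}
    (hr : IsCoherentConfiguration r.classes) {p q : Ω × Ω} (hpq : r p q) : r p.swap q.swap := by
  have h := hr.2.2.2.1 _ (r.setOf_rel_mem_classes q)
  have hq : q.swap ∈ Prod.swap '' {x | r x q} := ⟨q, r.refl q, rfl⟩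
  have hp : p.swap ∈ Prod.swap '' {x | r x q} := ⟨p, hpq, rfl⟩
  rw [Setoid.eq_setOf_rel_of_mem h hq] at hp
  exact hp

theorem IsAlgebraicIso.exists_equiv [Finite Ω] [Finite Ω'] {r : Setoid (Ω × Ω)}
    {r' : Setoid (Ω' × Ω')} {ψ : Set (Ω × Ω) → Set (Ω' × Ω')}
    (hψ : IsAlgebraicIso r.classes r'.classes ψ) {p : Ω × Ω} {p' : Ω' × Ω'}
    (hp : p' ∈ ψ {q | r q p}) :
    ∃ e : Ω ≃ Ω', ∀ γ, (p'.1, e γ) ∈ ψ {q | r q (p.1, γ)} ∧ (e γ, p'.2) ∈ ψ {q | r q (γ, p.2)} := by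
  obtain ⟨hmaps, hinj, hsurj, hcard⟩ := hψ
  have hf : ∀ A ∈ r.classes, ∀ x, ψ {q | r q x} = ψ A ↔ x ∈ A := by
    refine fun A hA x => ⟨fun h => ?_, fun h => by rw [Setoid.eq_setOf_rel_of_mem hA h]⟩
    rw [← hinj (r.setOf_rel_mem_classes x) hA h]
    exact r.refl x
  have hg : ∀ A ∈ r.classes, ∀ x', {q' | r' q' x'} = ψ A ↔ x' ∈ ψ A := by
    refine fun A hA x' => ⟨fun h => ?_, fun h => (Setoid.eq_setOf_rel_of_mem (hmaps hA) h).symm⟩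
    rw [← h]
    exact r'.refl x'
  obtain ⟨e, he⟩ := exists_equiv_of_card_fiber_eq
    (fun γ => (ψ {q | r q (p.1, γ)}, ψ {q | r q (γ, p.2)}))
    (fun γ' => ({q' | r' q' (p'.1, γ')}, {q' | r' q' (γ', p'.2)})) (by
      rintro ⟨a, b⟩
      by_cases hab : a ∈ r'.classes ∧ b ∈ r'.classes
      · obtain ⟨A, hA, rfl⟩ := hsurj hab.1
        obtain ⟨B, hB, rfl⟩ := hsurj hab.2
        simp only [Prod.mk.injEq, hf A hA, hf B hB, hg A hA, hg B hB]
        exact hcard A hA B hB _ (r.setOf_rel_mem_classes p) p (r.refl p) p' hp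
      · have h₁ : IsEmpty {γ // (ψ {q | r q (p.1, γ)}, ψ {q | r q (γ, p.2)}) = (a, b)} := by
          refine ⟨fun ⟨γ, hγ⟩ => hab ?_⟩
          rw [Prod.mk.injEq] at hγ
          rw [← hγ.1, ← hγ.2]
          exact ⟨hmaps (r.setOf_rel_mem_classes _), hmaps (r.setOf_rel_mem_classes _)⟩
        have h₂ : IsEmpty
            {γ' // ({q' | r' q' (p'.1, γ')}, {q' | r' q' (γ', p'.2)}) = (a, b)} := by
          refine ⟨fun ⟨γ, hγ⟩ => hab ?_⟩
          rw [Prod.mk.injEq] at hγ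
          rw [← hγ.1, ← hγ.2]
          exact ⟨r'.setOf_rel_mem_classes _, r'.setOf_rel_mem_classes _⟩
        rw [Nat.card_of_isEmpty, Nat.card_of_isEmpty])
  refine ⟨e, fun γ => ?_⟩
  have h := he γ
  rw [Prod.mk.injEq] at h
  rw [← h.1, ← h.2]
  exact ⟨r'.refl _, r'.refl _⟩

theorem IsCoherentConfiguration.isMatching [Finite Ω] {r : Setoid (Ω × Ω)}
    (hr : IsCoherentConfiguration r.classes) : IsMatching (r : Ω × Ω → Ω × Ω → Prop) where
  left_total p := ⟨p, r.refl p⟩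
  right_total p := ⟨p, r.refl p⟩
  diag _ _ := hr.diag_iff
  swap _ _ := hr.swap
  exists_equiv p q hpq := by
    have hid : IsAlgebraicIso r.classes r.classes id :=
      ⟨Set.mapsTo_id _, Set.injOn_id _, Set.surjOn_id _, hr.2.2.2.2⟩
    obtain ⟨e, he⟩ := hid.exists_equiv (p := p) (p' := q) (r.symm hpq)
    exact ⟨e, fun γ => ⟨r.symm (he γ).1, r.symm (he γ).2⟩⟩

theorem IsAlgebraicIso.mem_iff {r : Setoid (Ω × Ω)} {r' : Setoid (Ω' × Ω')}
    {ψ : Set (Ω × Ω) → Set (Ω' × Ω')} (hψ : IsAlgebraicIso r.classes r'.classes ψ)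
    {p q : Ω × Ω} {p' q' : Ω' × Ω'} (hp : p' ∈ ψ {x | r x p}) (hq : q' ∈ ψ {x | r x q}) :
    r p q ↔ r' p' q' := by
  have hp' := Setoid.eq_setOf_rel_of_mem (hψ.1 (r.setOf_rel_mem_classes p)) hp
  have hq' := Setoid.eq_setOf_rel_of_mem (hψ.1 (r.setOf_rel_mem_classes q)) hq
  constructor
  · intro h
    rw [Setoid.eq_setOf_rel_of_mem (r.setOf_rel_mem_classes q) (show p ∈ {x | r x q} from h), hp']
      at hq
    exact r'.symm hq
  · intro h
    have heq : ψ {x | r x p} = ψ {x | r x q} := by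
      rw [hq']
      exact Setoid.eq_setOf_rel_of_mem (hψ.1 (r.setOf_rel_mem_classes p))
        (by rw [hp']; exact r'.symm h)
    have := hψ.2.1 (r.setOf_rel_mem_classes p) (r.setOf_rel_mem_classes q) heq
    have hpp : p ∈ {x | r x p} := r.refl p
    rw [this] at hpp
    exact hpp

theorem IsAlgebraicIso.isMatching [Finite Ω] [Finite Ω'] {r : Setoid (Ω × Ω)}
    {r' : Setoid (Ω' × Ω')} {ψ : Set (Ω × Ω) → Set (Ω' × Ω')}
    (hr : IsCoherentConfiguration r.classes) (hr' : IsCoherentConfiguration r'.classes)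
    (hψ : IsAlgebraicIso r.classes r'.classes ψ) :
    IsMatching fun p p' => p' ∈ ψ {q | r q p} := by
  have hdiag : ∀ p p', p' ∈ ψ {q | r q p} → (p.1 = p.2 ↔ p'.1 = p'.2) := by
    intro p p' hp
    obtain ⟨e, he⟩ := hψ.exists_equiv hp
    constructor
    · intro h
      obtain ⟨γ, hγ⟩ := e.surjective p'.2
      have h' := he γ
      rw [hγ] at h'
      have h₁ : r p (p.1, γ) := (hψ.mem_iff hp h'.1).2 (r'.refl _)
      have h₂ : p.1 = γ := (hr.diag_iff h₁).1 h
      rw [← h₂] at h'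
      exact (hr'.diag_iff ((hψ.mem_iff hp h'.2).1 (r.refl _))).2 rfl
    · intro h
      have h' := he p.2
      have h₁ : r' p' (p'.1, e p.2) := (hψ.mem_iff hp h'.1).1 (r.refl _)
      have h₂ : p'.1 = e p.2 := (hr'.diag_iff h₁).1 h
      rw [← h₂] at h'
      exact (hr.diag_iff ((hψ.mem_iff hp h'.2).2 (r'.refl _))).2 rfl
  refine ⟨fun p => ?_, fun p' => ?_, hdiag, fun p p' hp => ?_, fun p p' hp => hψ.exists_equiv hp⟩
  · obtain ⟨p', hp'⟩ := hψ.1 (r.setOf_rel_mem_classes p)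
    exact ⟨p', by rw [hp']; exact r'.refl p'⟩
  · obtain ⟨_, ⟨p, rfl⟩, hp⟩ := hψ.2.2.1 (r'.setOf_rel_mem_classes p')
    exact ⟨p, by rw [hp]; exact r'.refl p'⟩
  · obtain ⟨e, he⟩ := hψ.exists_equiv hp
    have h₁ : p'.1 = e p.1 := (hdiag _ _ (he p.1).1).1 rfl
    have h₂ := (he p.1).1
    rw [← h₁] at h₂
    obtain ⟨e', he'⟩ := hψ.exists_equiv h₂
    have h₃ : r' (p'.1, e' p.2) p' := (hψ.mem_iff (he' p.2).1 hp).1 (r.refl _)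
    have h₄ : ψ {q | r q p.swap} = _ :=
      Setoid.eq_setOf_rel_of_mem (hψ.1 (r.setOf_rel_mem_classes _)) (he' p.2).2
    rw [h₄]
    exact r'.symm (hr'.swap h₃)

theorem card_triangles_eq {p : Ω × Ω} {p' : Ω' × Ω'} {A B : Set (Ω × Ω)} {A' B' : Set (Ω' × Ω')}
    (e : Ω ≃ Ω') (hA : ∀ γ, (p.1, γ) ∈ A ↔ (p'.1, e γ) ∈ A')
    (hB : ∀ γ, (γ, p.2) ∈ B ↔ (e γ, p'.2) ∈ B') :
    Nat.card {γ | (p.1, γ) ∈ A ∧ (γ, p.2) ∈ B} =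
      Nat.card {γ' | (p'.1, γ') ∈ A' ∧ (γ', p'.2) ∈ B'} :=
  Nat.card_congr (e.subtypeEquiv fun γ => and_congr (hA γ) (hB γ))

theorem IsMatching.isCoherentConfiguration {r : Setoid (Ω × Ω)}
    (hr : IsMatching (r : Ω × Ω → Ω × Ω → Prop)) : IsCoherentConfiguration r.classes := by
  refine ⟨?_, Setoid.classes_eqv_classes, ?_, ?_, ?_⟩
  · rintro _ ⟨p, rfl⟩
    exact ⟨p, r.refl p⟩
  · refine ⟨{u | u ∈ r.classes ∧ u ⊆ {p | p.1 = p.2}}, fun u hu => hu.1, ?_⟩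
    refine Set.Subset.antisymm (fun p hp => ?_) (Set.sUnion_subset fun u hu => hu.2)
    exact ⟨_, ⟨r.setOf_rel_mem_classes p, fun q hq => (hr.diag q p hq).2 hp⟩, r.refl p⟩
  · rintro _ ⟨p, rfl⟩
    refine ⟨p.swap, ?_⟩
    ext q
    rw [Set.image_swap_eq_preimage_swap]
    exact ⟨fun h => by simpa using hr.swap _ _ h, fun h => by simpa using hr.swap _ _ h⟩
  · rintro _ ⟨a, rfl⟩ _ ⟨b, rfl⟩ _ ⟨c, rfl⟩ p hp q hq
    obtain ⟨e, he⟩ := hr.exists_equiv p q (r.trans hp (r.symm hq))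
    exact card_triangles_eq e
      (fun γ => ⟨r.trans (r.symm (he γ).1), r.trans (he γ).1⟩)
      (fun γ => ⟨r.trans (r.symm (he γ).2), r.trans (he γ).2⟩)

theorem IsMatching.isAlgebraicIso {r : Setoid (Ω × Ω)} {r' : Setoid (Ω' × Ω')}
    {M : Ω × Ω → Ω' × Ω' → Prop} (hM : IsMatching M)
    (hrr : ∀ p q p' q', M p p' → M q q' → (r p q ↔ r' p' q'))
    (hl : ∀ p q p', r p q → M q p' → M p p') :
    IsAlgebraicIso r.classes r'.classes fun u => {p' | ∃ p ∈ u, M p p'} := by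
  have himage : ∀ p p', M p p' → {q' | ∃ q ∈ {q | r q p}, M q q'} = {q' | r' q' p'} := by
    intro p p' hp
    ext q'
    constructor
    · rintro ⟨q, hq, hqq⟩
      exact (hrr _ _ _ _ hqq hp).1 hq
    · intro h
      obtain ⟨q, hq⟩ := hM.right_total q'
      exact ⟨q, (hrr _ _ _ _ hq hp).2 h, hq⟩
  have hmem : ∀ p p', M p p' → ∀ A ∈ r.classes, (p ∈ A ↔ p' ∈ {q' | ∃ q ∈ A, M q q'}) := by
    rintro p p' hp _ ⟨a, rfl⟩
    refine ⟨fun h => ⟨p, h, hp⟩, ?_⟩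
    rintro ⟨q, hq, hqq⟩
    exact r.trans ((hrr _ _ _ _ hp hqq).2 (r'.refl _)) hq
  refine ⟨?_, ?_, ?_, ?_⟩
  · rintro _ ⟨p, rfl⟩
    obtain ⟨p', hp⟩ := hM.left_total p
    exact ⟨p', himage p p' hp⟩
  · intro A hA B hB hAB
    obtain ⟨p, hp⟩ := Setoid.nonempty_of_mem_partition (Setoid.isPartition_classes r) hA
    obtain ⟨p', hpp⟩ := hM.left_total p
    refine Setoid.eq_of_mem_classes hA hp hB ?_
    exact (hmem p p' hpp B hB).2 (hAB.subset ((hmem p p' hpp A hA).1 hp))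
  · rintro _ ⟨p', rfl⟩
    obtain ⟨p, hp⟩ := hM.right_total p'
    exact ⟨_, r.setOf_rel_mem_classes p, himage p p' hp⟩
  · rintro A hA B hB _ ⟨c, rfl⟩ p hp p' ⟨q, hq, hqp⟩
    obtain ⟨e, he⟩ := hM.exists_equiv p p' (hl p q p' (r.trans hp (r.symm hq)) hqp)
    exact card_triangles_eq e (fun γ => hmem _ _ (he γ).1 A hA) (fun γ => hmem _ _ (he γ).2 B hB)

end Bridge

section PointExtension

variable {Ω Ω' : Type*}

/-- The coherent equivalence relations below `s` for which all the pairs `(y i, y i)` are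
isolated. -/
def pointedCoherent (s : Setoid (Ω × Ω)) {k : ℕ} (y : Fin k → Ω) : Set (Setoid (Ω × Ω)) :=
  {r | IsMatching (r : Ω × Ω → Ω × Ω → Prop) ∧ r ≤ s ∧ ∀ i q, r q (y i, y i) → q = (y i, y i)}

theorem sSup_mem_pointedCoherent (s : Setoid (Ω × Ω)) {k : ℕ} (y : Fin k → Ω) :
    sSup (pointedCoherent s y) ∈ pointedCoherent s y := by
  refine ⟨IsMatching.sSup fun r hr => hr.1, sSup_le fun r hr => hr.2.1, fun i q hq => ?_⟩
  have hle : sSup (pointedCoherent s y) ≤ Setoid.ker (fun q => q = (y i, y i)) :=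
    sSup_le fun r hr p q hpq => propext
      ⟨by rintro rfl; exact hr.2.2 i q (r.symm hpq), by rintro rfl; exact hr.2.2 i p hpq⟩
  have h : (q = (y i, y i)) = ((y i, y i) = (y i, y i)) := hle hq
  simpa using h

theorem isPointExtension_classes_iff [Finite Ω] {s r : Setoid (Ω × Ω)} {k : ℕ} {y : Fin k → Ω} :
    IsPointExtension s.classes y r.classes ↔ IsGreatest (pointedCoherent s y) r := by
  have key : ∀ r : Setoid (Ω × Ω), (IsCoherentConfiguration r.classes ∧
      Refines s.classes r.classes ∧ ∀ i, {(y i, y i)} ∈ r.classes) ↔ r ∈ pointedCoherent s y := by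
    intro r
    refine and_congr ⟨fun h => h.isMatching, fun h => h.isCoherentConfiguration⟩
      (and_congr refines_classes_iff (forall_congr' fun i => singleton_mem_classes_iff))
  constructor
  · rintro ⟨h₁, h₂, h₃, h₄⟩
    refine ⟨(key r).1 ⟨h₁, h₂, h₃⟩, fun t ht => ?_⟩
    obtain ⟨ht₁, ht₂, ht₃⟩ := (key t).2 ht
    exact refines_classes_iff.1 (h₄ _ ht₁ ht₂ ht₃)
  · rintro ⟨h, hmax⟩
    obtain ⟨h₁, h₂, h₃⟩ := (key r).2 h
    refine ⟨h₁, h₂, h₃, fun T hT hsT hyT => ?_⟩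
    obtain ⟨t, rfl⟩ := hT.exists_classes_eq
    exact refines_classes_iff.2 (hmax ((key t).1 ⟨hT, hsT, hyT⟩))

/-- The transport of an equivalence relation along a relation whose fibres on the left are
contained in its classes. -/
def transportSetoid (M : Ω × Ω → Ω' × Ω' → Prop) (r : Setoid (Ω × Ω))
    (hsurj : ∀ p', ∃ p, M p p') (hM : ∀ p q p', M p p' → M q p' → r p q) : Setoid (Ω' × Ω') where
  r := Relation.Comp (flip M) (Relation.Comp r M)
  iseqv := by
    refine ⟨fun p' => ?_, ?_, ?_⟩
    · obtain ⟨p, hp⟩ := hsurj p'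
      exact ⟨p, hp, p, r.refl p, hp⟩
    · rintro p' q' ⟨p, hp, q, hpq, hq⟩
      exact ⟨q, hq, p, r.symm hpq, hp⟩
    · rintro p' q' u' ⟨p, hp, q, hpq, hq⟩ ⟨q₁, hq₁, u, hqu, hu⟩
      exact ⟨p, hp, u, r.trans hpq (r.trans (hM _ _ _ hq hq₁) hqu), hu⟩

theorem transportSetoid_mem_pointedCoherent {M : Ω × Ω → Ω' × Ω' → Prop} {r s : Setoid (Ω × Ω)}
    {s' : Setoid (Ω' × Ω')} {k : ℕ} {y : Fin k → Ω} {y' : Fin k → Ω'} (h : IsMatching M)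
    (hM : ∀ p q p', M p p' → M q p' → r p q) (hr : r ∈ pointedCoherent s y)
    (hs : ∀ p q p' q', M p p' → M q q' → s p q → s' p' q')
    (hy : ∀ i, M (y i, y i) (y' i, y' i)) (hy' : ∀ i p', M (y i, y i) p' → p' = (y' i, y' i)) :
    transportSetoid M r h.right_total hM ∈ pointedCoherent s' y' := by
  refine ⟨h.flip.comp (hr.1.comp h), ?_, ?_⟩
  · rintro p' q' ⟨p, hp, q, hpq, hq⟩
    exact hs _ _ _ _ hp hq (hr.2.1 hpq)
  · rintro i p' ⟨p, hp, q, hpq, hq⟩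
    obtain rfl : p = (y i, y i) := hr.2.2 i p (r.trans hpq (hM _ _ _ hq (hy i)))
    exact hy' i p' hp

/-- Extendability of an algebraic isomorphism at a tuple follows from a matching that need only
be finer than the point extension. -/
theorem extendableAt_of_isMatching [Finite Ω] [Finite Ω'] {s : Setoid (Ω × Ω)}
    {s' : Setoid (Ω' × Ω')} {φ : Set (Ω × Ω) → Set (Ω' × Ω')} {M : Ω × Ω → Ω' × Ω' → Prop}
    {t : Setoid (Ω × Ω)} {t' : Setoid (Ω' × Ω')} {k : ℕ} {y : Fin k → Ω} {y' : Fin k → Ω'}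
    (h : IsMatching M) (ht : t ∈ pointedCoherent s y) (ht' : t' ∈ pointedCoherent s' y')
    (htt : ∀ p q p' q', M p p' → M q q' → (t p q ↔ t' p' q'))
    (hss : ∀ p q p' q', M p p' → M q q' → (s p q ↔ s' p' q'))
    (hφ : ∀ u ∈ s.classes, φ u = {p' | ∃ p ∈ u, M p p'})
    (hy : ∀ i, M (y i, y i) (y' i, y' i)) :
    ExtendableAt s.classes s'.classes φ y := by
  set r := sSup (pointedCoherent s y)
  set r₀' := sSup (pointedCoherent s' y')
  have hr : r ∈ pointedCoherent s y := sSup_mem_pointedCoherent s y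
  have hr₀' : r₀' ∈ pointedCoherent s' y' := sSup_mem_pointedCoherent s' y'
  have htr : t ≤ r := le_sSup ht
  have htr' : t' ≤ r₀' := le_sSup ht'
  have hM : ∀ p q p', M p p' → M q p' → r p q := fun p q p' hp hq =>
    htr ((htt _ _ _ _ hp hq).2 (t'.refl _))
  have hM' : ∀ p' q' p, M p p' → M p q' → r₀' p' q' := fun p' q' p hp hq =>
    htr' ((htt _ _ _ _ hp hq).1 (t.refl _))
  have hy₁ : ∀ i p', M (y i, y i) p' → p' = (y' i, y' i) := fun i p' hp =>
    ht'.2.2 i p' ((htt _ _ _ _ hp (hy i)).1 (t.refl _))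
  have hy₂ : ∀ i p, M p (y' i, y' i) → p = (y i, y i) := fun i p hp =>
    ht.2.2 i p ((htt _ _ _ _ hp (hy i)).2 (t'.refl _))
  set r' := transportSetoid M r h.right_total hM
  have hr' : r' ∈ pointedCoherent s' y' := transportSetoid_mem_pointedCoherent h hM hr
    (fun p q p' q' hp hq => (hss p q p' q' hp hq).1) hy hy₁
  have hback : transportSetoid (flip M) r₀' h.flip.right_total hM' ∈ pointedCoherent s y :=
    transportSetoid_mem_pointedCoherent h.flip hM' hr₀'
      (fun p q p' q' hp hq => (hss p' q' p q hp hq).2) hy hy₂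
  have hle : r₀' ≤ r' := by
    intro p' q' hpq
    obtain ⟨p, hp⟩ := h.right_total p'
    obtain ⟨q, hq⟩ := h.right_total q'
    exact ⟨p, hp, q, le_sSup hback ⟨p', hp, q', hpq, hq⟩, hq⟩
  have hN : IsMatching (Relation.Comp r M) := hr.1.comp h
  refine ⟨y', r.classes, r'.classes, fun u => {p' | ∃ p ∈ u, Relation.Comp r M p p'},
    isPointExtension_classes_iff.2 ⟨hr, fun _ hx => le_sSup hx⟩,
    isPointExtension_classes_iff.2 ⟨hr', fun _ hx => (le_sSup hx).trans hle⟩,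
    hN.isAlgebraicIso ?_ ?_, ?_, fun i => ?_⟩
  · rintro p q p' q' ⟨a, hpa, ha⟩ ⟨b, hqb, hb⟩
    constructor
    · intro hpq
      exact ⟨a, ha, b, r.trans (r.symm hpa) (r.trans hpq hqb), hb⟩
    · rintro ⟨a₁, ha₁, b₁, hab, hb₁⟩
      exact r.trans hpa (r.trans (hM _ _ _ ha ha₁) (r.trans hab
        (r.trans (hM _ _ _ hb₁ hb) (r.symm hqb))))
  · rintro p q p' hpq ⟨a, hqa, ha⟩
    exact ⟨a, r.trans hpq hqa, ha⟩
  · intro u hu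
    rw [hφ u hu]
    ext p'
    constructor
    · rintro ⟨p, hp, hpp⟩
      refine ⟨_, ⟨{q | r q p}, ⟨r.setOf_rel_mem_classes p, fun q hq => ?_⟩, rfl⟩,
        p, r.refl p, p, r.refl p, hpp⟩
      rw [Setoid.eq_setOf_rel_of_mem hu hp]
      exact hr.2.1 hq
    · rintro ⟨_, ⟨v, ⟨hv, hvu⟩, rfl⟩, p, hp, q, hpq, hq⟩
      refine ⟨q, ?_, hq⟩
      rw [Setoid.eq_setOf_rel_of_mem hu (hvu hp)]
      exact hr.2.1 (r.symm hpq)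
  · refine Set.Subset.antisymm ?_ ?_
    · rintro p' ⟨_, rfl, q, hq, hqp⟩
      obtain rfl : q = (y i, y i) := hr.2.2 i q (r.symm hq)
      exact hy₁ i p' hqp
    · rintro _ rfl
      exact ⟨_, rfl, _, r.refl _, hy i⟩

theorem ExtendsAlgIso.apply_eq {s t : Setoid (Ω × Ω)} {φ ψ : Set (Ω × Ω) → Set (Ω' × Ω')}
    (h : ExtendsAlgIso s.classes t.classes φ ψ) (hts : t ≤ s) {u : Set (Ω × Ω)}
    (hu : u ∈ s.classes) : φ u = {p' | ∃ p ∈ u, p' ∈ ψ {q | t q p}} := by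
  rw [h u hu]
  ext p'
  constructor
  · rintro ⟨_, ⟨_, ⟨⟨p, rfl⟩, hpu⟩, rfl⟩, hp⟩
    exact ⟨p, hpu (t.refl p), hp⟩
  · rintro ⟨p, hp, hpp⟩
    refine ⟨_, ⟨_, ⟨t.setOf_rel_mem_classes p, fun q hq => ?_⟩, rfl⟩, hpp⟩
    rw [Setoid.eq_setOf_rel_of_mem hu hp]
    exact hts hq

theorem ExtendableAt.comp [Finite Ω] [Finite Ω'] {S : Set (Set (Ω × Ω))}
    {S' : Set (Set (Ω' × Ω'))} {φ : Set (Ω × Ω) → Set (Ω' × Ω')}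
    (hS : IsCoherentConfiguration S) (hS' : IsCoherentConfiguration S')
    (hφ : IsAlgebraicIso S S' φ) {m k : ℕ} {x : Fin m → Ω} (hx : ExtendableAt S S' φ x)
    (f : Fin k → Fin m) : ExtendableAt S S' φ (x ∘ f) := by
  obtain ⟨s, rfl⟩ := hS.exists_classes_eq
  obtain ⟨s', rfl⟩ := hS'.exists_classes_eq
  obtain ⟨x', T, T', ψ, hT, hT', hψ, hext, hψx⟩ := hx
  obtain ⟨t, rfl⟩ := hT.1.exists_classes_eq
  obtain ⟨t', rfl⟩ := hT'.1.exists_classes_eq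
  have ht := (isPointExtension_classes_iff.1 hT).1
  have ht' := (isPointExtension_classes_iff.1 hT').1
  have hφ_apply := fun u hu => hext.apply_eq ht.2.1 (u := u) hu
  have hmem : ∀ p p', p' ∈ ψ {q | t q p} → p' ∈ φ {q | s q p} := fun p p' hp => by
    rw [hφ_apply _ (s.setOf_rel_mem_classes p)]
    exact ⟨p, s.refl p, hp⟩
  refine extendableAt_of_isMatching (y' := x' ∘ f) (hψ.isMatching hT.1 hT'.1)
    ⟨ht.1, ht.2.1, fun i => ht.2.2 (f i)⟩ ⟨ht'.1, ht'.2.1, fun i => ht'.2.2 (f i)⟩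
    (fun p q p' q' hp hq => hψ.mem_iff hp hq)
    (fun p q p' q' hp hq => hφ.mem_iff (hmem _ _ hp) (hmem _ _ hq)) hφ_apply fun i => ?_
  have h := Setoid.eq_setOf_rel_of_mem (hT.2.2.1 (f i)) (Set.mem_singleton _)
  simp only [Function.comp_apply]
  rw [← h, hψx]
  rfl

end PointExtension

theorem extendable_of_extendable_at_longer_tuples {Ω Ω' : Type*}
    [Finite Ω] [Finite Ω'] [Nonempty Ω] [Nonempty Ω']
    (S : Set (Set (Ω × Ω))) (S' : Set (Set (Ω' × Ω')))
    (hS : IsCoherentConfiguration S) (hS' : IsCoherentConfiguration S')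
    (hSd : {p : Ω × Ω | p.1 = p.2} ∈ S) (hS'd : {p : Ω' × Ω' | p.1 = p.2} ∈ S')
    (φ : Set (Ω × Ω) → Set (Ω' × Ω')) (hφ : IsAlgebraicIso S S' φ) (m : ℕ)
    (h : ∀ x : Fin m → Ω, ExtendableAt S S' φ x) :
    ∀ k : ℕ, k ≤ m → ∀ y : Fin k → Ω, ExtendableAt S S' φ y := by
  intro k hkm y
  let x : Fin m → Ω := fun i => if hi : i.1 < k then y ⟨i, hi⟩ else Classical.arbitrary Ω
  have hxy : x ∘ Fin.castLE hkm = y := by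
    funext i
    simp [x]
  exact hxy ▸ (h x).comp hS hS' hφ (Fin.castLE hkm)
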